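/- Let i ≥ −1, n ≥ 1 and 0 ≤ r ≤ n+i. For each C in the domain of φ_{i,n}^r, the image φ_{i,n}^r(C) has exactly one more plus-full-set than C; that is, #{j : φ_{i,n}^r(C) has a j⁺-full-set} = #{j : C has a j⁺-full-set} + 1. -/

import Mathlib

/-!
Common definitions for formalizing "A recursion on maximal chains in the Tamari lattices"
(L. Nelson).

* Young diagrams are encoded by their row-length functions `lam : ℕ → ℕ` (rows indexed from 1,
  with `lam 0 = 0`).
* Dyck paths are lists of steps (north/east).
* Tableaux are encoded by entry functions `f : ℕ × ℕ → ℕ` (1-indexed boxes; value `0` means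
  "no box").  The label of box `(x, y)` is `f (x, y)`.
-/

noncomputable section

namespace TamariMaxChains

/-- A step of a lattice path: north or east. -/
inductive Step : Type
  | N : Step
  | E : Step
deriving DecidableEq

/-- Number of north steps of a path. -/
def nCount (p : List Step) : ℕ := p.count Step.N

/-- Number of east steps of a path. -/
def eCount (p : List Step) : ℕ := p.count Step.E

/-- `p` is a Dyck path: equally many norths and easts, and every prefix has at least as many
north steps as east steps (the path never goes below the diagonal `y = x`). -/
def IsDyck (p : List Step) : Prop :=
  nCount p = eCount p ∧ ∀ q : List Step, q <+: p → eCount q ≤ nCount q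

/-- `q` is a prime Dyck path: it meets the slope-one line joining its endpoints only at its
endpoints. -/
def IsPrimeDyck (q : List Step) : Prop :=
  q ≠ [] ∧ nCount q = eCount q ∧
    ∀ s : List Step, s <+: q → s ≠ [] → s ≠ q → eCount s < nCount s

/-- Covering relation of the Tamari lattice on Dyck paths:  `TamariCoverD P' P` means `P'`
covers `P`, i.e. `P'` is obtained from `P` by swapping an east step that is followed by a north
step with the prime Dyck subpath following it. -/
def TamariCoverD (P' P : List Step) : Prop :=
  ∃ a q b : List Step, IsPrimeDyck q ∧
    P = a ++ Step.E :: (q ++ b) ∧ P' = a ++ (q ++ Step.E :: b)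

/-- `lam` is the row-length function of a Young diagram: rows are indexed from `1`,
`lam x` is the number of boxes in row `x`, rows weakly decrease, finitely many boxes. -/
def IsDiagram (lam : ℕ → ℕ) : Prop :=
  lam 0 = 0 ∧ (∀ x, 1 ≤ x → lam (x + 1) ≤ lam x) ∧ ∃ N, ∀ x, N ≤ x → lam x = 0

/-- The height (number of north steps) of the prime path of row `d ≥ 1` of the Young diagram
with row lengths `lam`:  the least `t ≥ 1` such that either `t = d` (row `0` being regarded as
an infinite row of boxes) or row `d - t` has length at least `lam d + t`. -/
def primeHeight (lam : ℕ → ℕ) (d : ℕ) : ℕ :=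
  sInf {t | 1 ≤ t ∧ (t = d ∨ (t < d ∧ lam d + t ≤ lam (d - t)))}

/-- The last box of row `d` is a corner box (last box of its row and lowest box of
its column). -/
def IsCorner (lam : ℕ → ℕ) (d : ℕ) : Prop := 1 ≤ d ∧ 1 ≤ lam d ∧ lam (d + 1) < lam d

/-- The result of removing the `B`-strip of the last box `B` of row `d`: the last box of each of
the rows `d - h + 1, …, d` is removed, where `h` is the height of the prime path of row `d`. -/
def removeStrip (lam : ℕ → ℕ) (d : ℕ) : ℕ → ℕ := fun x =>
  if d + 1 ≤ x + primeHeight lam d ∧ x ≤ d then lam x - 1 else lam x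

/-- Covering relation of the Tamari lattice on Young diagrams:  `mu` covers `lam` iff `mu` is
obtained from `lam` by removing the `B`-strip of a corner box `B`. -/
def TamariCoverY (mu lam : ℕ → ℕ) : Prop := ∃ d, IsCorner lam d ∧ mu = removeStrip lam d

/-- The `B`-strip of the last box `B` of row `d`: the set of last boxes of rows
`d - h + 1, …, d`, where `h` is the height of the prime path of row `d`. -/
def stripSet (lam : ℕ → ℕ) (d : ℕ) : Set (ℕ × ℕ) :=
  {b | b.2 = lam b.1 ∧ 1 ≤ b.2 ∧ d + 1 ≤ b.1 + primeHeight lam d ∧ b.1 ≤ d}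

/-- The enclosure of the `B`-strip of the last box `B = (d, lam d)` of row `d`: all boxes
`(x, y)` with `d - h ≤ x ≤ d` and `lam d ≤ y ≤ lam d + h`, where row `0` is regarded as an
infinite row of boxes. -/
def enclosure (lam : ℕ → ℕ) (d : ℕ) : Set (ℕ × ℕ) :=
  {b | (b.1 = 0 ∨ b.2 ≤ lam b.1) ∧ 1 ≤ b.2 ∧
    d ≤ b.1 + primeHeight lam d ∧ b.1 ≤ d ∧ lam d ≤ b.2 ∧ b.2 ≤ lam d + primeHeight lam d}

/-- The Dyck path of length `2 n` corresponding to the Young diagram `lam` contained in the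
staircase `δ_{n-1}` (the Dyck path is the silhouette of the Young diagram). -/
def toDyck (n : ℕ) (lam : ℕ → ℕ) : List Step :=
  ((List.range n).flatMap fun k =>
    List.replicate (lam (n - k) - lam (n - k + 1)) Step.E ++ [Step.N]) ++
    List.replicate (n - lam 1) Step.E

/-- The prime path of row `d` of the Young diagram `lam`, as its list of steps (read from its
lower-left endpoint). -/
def primePathList (lam : ℕ → ℕ) (d : ℕ) : List Step :=
  Step.N :: ((((List.range (primeHeight lam d - 1)).flatMap fun j =>
    List.replicate (lam (d - 1 - j) - lam (d - j)) Step.E ++ [Step.N])) ++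
    List.replicate (lam d + primeHeight lam d - lam (d - (primeHeight lam d - 1))) Step.E)

/-- `S` translates to `S'` by `p` units down and `q` units to the right. -/
def TranslatesBy (p q : ℤ) (S S' : Set (ℕ × ℕ)) : Prop :=
  ∀ x y : ℕ, (x, y) ∈ S' ↔ ∃ a b : ℕ, (a, b) ∈ S ∧ (x : ℤ) = a + p ∧ (y : ℤ) = b + q

/-- `S` translates to `S'`. -/
def Translates (S S' : Set (ℕ × ℕ)) : Prop := ∃ p q : ℤ, TranslatesBy p q S S'

/-- The length of a tableau: its number of distinct labels (for an honest tableau, labels are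
exactly `1, …, tlen f`). -/
def tlen (f : ℕ × ℕ → ℕ) : ℕ := sSup {v | v ≠ 0 ∧ ∃ b, f b = v}

/-- The number of boxes in row `x` of a tableau. -/
def rowLen (f : ℕ × ℕ → ℕ) (x : ℕ) : ℕ := sSup {y | f (x, y) ≠ 0}

/-- The number of boxes in column `y` of a tableau. -/
def colLen (f : ℕ × ℕ → ℕ) (y : ℕ) : ℕ := sSup {x | f (x, y) ≠ 0}

/-- `f` is (the entry function of) a tableau: the support is a Young diagram (1-indexed),
rows strictly increase, columns weakly increase, and the set of labels is exactly
`{1, …, tlen f}`. -/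
def IsTableau (f : ℕ × ℕ → ℕ) : Prop :=
  (∀ y, f (0, y) = 0) ∧ (∀ x, f (x, 0) = 0) ∧
  {b : ℕ × ℕ | f b ≠ 0}.Finite ∧
  (∀ x y x' y', 1 ≤ x' → x' ≤ x → 1 ≤ y' → y' ≤ y → f (x, y) ≠ 0 → f (x', y') ≠ 0) ∧
  (∀ x y, f (x, y) ≠ 0 → f (x, y + 1) ≠ 0 → f (x, y) < f (x, y + 1)) ∧
  (∀ x y, f (x, y) ≠ 0 → f (x + 1, y) ≠ 0 → f (x, y) ≤ f (x + 1, y)) ∧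
  (∀ v, 1 ≤ v → (v ≤ tlen f ↔ ∃ b, f b = v))

/-- `T^(r)`: the subtableau of all entries at most `r`. -/
def trunc (f : ℕ × ℕ → ℕ) (r : ℕ) : ℕ × ℕ → ℕ := fun b => if f b ≤ r then f b else 0

/-- The shape (row-length function) of a tableau. -/
def shapeOf (f : ℕ × ℕ → ℕ) : ℕ → ℕ := fun x => rowLen f x

/-- The row index of the end-box of the `k`-set of `f` (the maximal row index of a box
labeled `k`). -/
def endRow (f : ℕ × ℕ → ℕ) (k : ℕ) : ℕ := sSup {x | ∃ y, f (x, y) = k}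

/-- `Y 0 ⋗ Y 1 ⋗ ⋯ ⋗ Y l` is a saturated chain in the Tamari order on Young diagrams whose
maximal element `Y 0` is the empty diagram (each `Y r` covers `Y (r+1)`). -/
def IsTamariChain (Y : ℕ → ℕ → ℕ) (l : ℕ) : Prop :=
  (∀ r, r ≤ l → IsDiagram (Y r)) ∧ (∀ x, Y 0 x = 0) ∧
    ∀ r, r < l → TamariCoverY (Y r) (Y (r + 1))

/-- The tableau `ψ(C)` of the saturated chain `C = (∅ = Y 0 ⋗ ⋯ ⋗ Y l)`: the boxes removed in
the transition `Y (r-1) ⋗ Y r` are labeled `r`; that is, each box of `Y l` is labeled by the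
least `r` such that the box belongs to `Y r`. -/
def psiFun (Y : ℕ → ℕ → ℕ) (l : ℕ) : ℕ × ℕ → ℕ := fun b =>
  if 1 ≤ b.1 ∧ 1 ≤ b.2 ∧ b.2 ≤ Y l b.1 then sInf {r | r ≤ l ∧ b.2 ≤ Y r b.1} else 0

/-- `f` is a `ψ`-tableau: it is in the image of `ψ`. -/
def IsPsiTab (f : ℕ × ℕ → ℕ) : Prop :=
  ∃ l Y, IsTamariChain Y l ∧ f = psiFun Y l

/-- Row lengths of the staircase shape `δ_{n-1} = (n-1, n-2, …, 1)`: row `x ≥ 1` has `n - x`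
boxes. -/
def dstair (n : ℕ) : ℕ → ℕ := fun x => if x = 0 then 0 else n - x

/-- `C_i(n)`, via `ψ`: the set of maximal chains of length `n + i` in the Tamari lattice `T_n`,
identified with the `ψ`-tableaux of length `n + i` and shape `δ_{n-1}`. -/
def MemC (i : ℤ) (n : ℕ) (f : ℕ × ℕ → ℕ) : Prop :=
  IsTableau f ∧ IsPsiTab f ∧ (∀ x, rowLen f x = dstair n x) ∧ (tlen f : ℤ) = (n : ℤ) + i

/-- The `r`-set of `f` (of shape `δ_{n-1}`) is a full-set with end-box `(k, n - k)`:
it begins in row `1` and ends in the outer diagonal, at the box `(k, n - k)`. -/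
def HasFullSetAt (f : ℕ × ℕ → ℕ) (n r k : ℕ) : Prop :=
  (∃ y, f (1, y) = r) ∧ 1 ≤ k ∧ k ≤ n - 1 ∧ f (k, n - k) = r ∧
    ∀ x y, f (x, y) = r → x ≤ k

/-- `f` has an `r`-full-set. -/
def HasFullSet (f : ℕ × ℕ → ℕ) (n r : ℕ) : Prop := ∃ k, HasFullSetAt f n r k

/-- `f` has an `r⁺`-full-set (plus-full-set): an `r`-full-set whose end-box `(k, n-k)` satisfies
`k = n - 1`, or `k ≤ n - 2` and the southwest neighbor has a smaller label. -/
def HasPlusFullSet (f : ℕ × ℕ → ℕ) (n r : ℕ) : Prop :=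
  ∃ k, HasFullSetAt f n r k ∧ (k = n - 1 ∨ (k ≤ n - 2 ∧ f (k + 1, n - k - 1) < r))

/-- `F_i^r(n)`: the set of `C ∈ C_i(n)` whose `r`-set is a plus-full-set and whose `j`-set is
not a plus-full-set for any `j ∈ [r-1]`. -/
def MemF (i : ℤ) (n : ℕ) (r : ℕ) (f : ℕ × ℕ → ℕ) : Prop :=
  MemC i n f ∧ HasPlusFullSet f n r ∧ ∀ j, 1 ≤ j → j < r → ¬ HasPlusFullSet f n j

/-- `N_i(n)`: the set of `C ∈ C_i(n)` having no plus-full-sets. -/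
def MemN (i : ℤ) (n : ℕ) (f : ℕ × ℕ → ℕ) : Prop :=
  MemC i n f ∧ ∀ r, ¬ HasPlusFullSet f n r

/-- `α_d`: shift all rows of index greater than `d` down one row and repeat row `d` in
row `d + 1`. -/
def alphaFun (d : ℕ) (f : ℕ × ℕ → ℕ) : ℕ × ℕ → ℕ := fun b =>
  if b.1 ≤ d then f b else f (b.1 - 1, b.2)

/-- `β_d`: append a box labeled `tlen f + 1` at the end of each of the rows `1, …, d`. -/
def betaFun (d : ℕ) (f : ℕ × ℕ → ℕ) : ℕ × ℕ → ℕ := fun b =>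
  if 1 ≤ b.1 ∧ b.1 ≤ d ∧ b.2 = rowLen f b.1 + 1 then tlen f + 1 else f b

/-- The number of boxes of row `x` of `f` whose label is at most `r` (these occupy an initial
segment of the row). -/
def lowLen (f : ℕ × ℕ → ℕ) (r x : ℕ) : ℕ := sSup {y | f (x, y) ≠ 0 ∧ f (x, y) ≤ r}

/-- The row index `d` used in the definition of `Ĉ(r)`: the minimal `k ∈ [n-1]` with
`C (k, n-k) ≤ r` if such `k` exists, and `n` otherwise. -/
def hatD (f : ℕ × ℕ → ℕ) (n r : ℕ) : ℕ :=
  sInf ({k | 1 ≤ k ∧ k ≤ n - 1 ∧ 1 ≤ f (k, n - k) ∧ f (k, n - k) ≤ r} ∪ {n})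

/-- `Ĉ(r)` for `C ∈ C_i(n)` and `0 ≤ r ≤ n + i`: starting from `β_d(α_d(C^(r)))` (where `d` is
as in `hatD`), the entries of `C` greater than `r` of row index less than `d` are translated one
unit to the right, those of row index greater than `d` are translated one unit down, and all
these labels are incremented by one. -/
def hatFun (f : ℕ × ℕ → ℕ) (n r : ℕ) : ℕ × ℕ → ℕ := fun b =>
  let d := hatD f n r
  let x := b.1
  let y := b.2
  if x = 0 ∨ y = 0 then 0
  else if x ≤ d then
    if f (x, y) ≠ 0 ∧ f (x, y) ≤ r then f (x, y)
    else if y = lowLen f r x + 1 then r + 1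
    else if r < f (x, y - 1) then f (x, y - 1) + 1
    else 0
  else if x = d + 1 then f (d, y)
  else if f (x - 1, y) = 0 then 0
  else if f (x - 1, y) ≤ r then f (x - 1, y)
  else f (x - 1, y) + 1

/-- `RepBy i m t r C0 C` : `C = (φ_{i,m+t-1}^{r 1} ∘ φ_{i,m+t-2}^{r 2} ∘ ⋯ ∘ φ_{i,m}^{r t}) C0`,
each factor being applied within its domain. -/
def RepBy (i : ℤ) (m t : ℕ) (r : ℕ → ℕ) (C0 C : ℕ × ℕ → ℕ) : Prop :=
  ∃ D : ℕ → ℕ × ℕ → ℕ, D 0 = C0 ∧ D t = C ∧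
    ∀ s, s < t →
      MemC i (m + s) (D s) ∧
      ((r (t - s) : ℤ) ≤ (m : ℤ) + s + i) ∧
      (∀ j, 1 ≤ j → j ≤ r (t - s) → ¬ HasPlusFullSet (D s) (m + s) j) ∧
      D (s + 1) = hatFun (D s) (m + s) (r (t - s))

/-- The set `𝕏_{d,n-1}^r` of Theorem 4.3: `ψ`-tableaux of length `r`, contained in `δ_{n-1}`,
whose row `d` has length `n - d` and whose prime path of row `d` has height `d`. -/
def MemX (d n r : ℕ) (f : ℕ × ℕ → ℕ) : Prop :=
  IsTableau f ∧ IsPsiTab f ∧ tlen f = r ∧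
    (∀ x, 1 ≤ x → rowLen f x ≤ n - x) ∧
    rowLen f d = n - d ∧
    primeHeight (shapeOf f) d = d

/-- The set `ℤ_{d,n}^{r+1}` of Theorem 4.3: `ψ`-tableaux of length `r + 1`, contained in `δ_n`,
such that rows `d` and `d+1` of the truncation at `r` are identical, the end-box of the
`(r+1)`-set is `(d, n-d+1)`, and the prime path of `(d, n-d+1)` has height `d`. -/
def MemZ (d n r : ℕ) (g : ℕ × ℕ → ℕ) : Prop :=
  IsTableau g ∧ IsPsiTab g ∧ tlen g = r + 1 ∧
    (∀ x, 1 ≤ x → rowLen g x ≤ n + 1 - x) ∧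
    (∀ y, trunc g r (d, y) = trunc g r (d + 1, y)) ∧
    g (d, n - d + 1) = r + 1 ∧ (∀ x y, g (x, y) = r + 1 → x ≤ d) ∧
    primeHeight (shapeOf g) d = d

section helpers

variable {n r : ℕ} {f : ℕ × ℕ → ℕ}

lemma supp_iff (hT : IsTableau f) (hs : ∀ x, rowLen f x = dstair n x) (x y : ℕ) :
    f (x, y) ≠ 0 ↔ 1 ≤ x ∧ 1 ≤ y ∧ x + y ≤ n := by
  obtain ⟨h0, h0', hfin, hdown, -, -, -⟩ := hT
  have hbdd : BddAbove {y | f (x, y) ≠ 0} := by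
    apply Set.Finite.bddAbove
    exact hfin.preimage (f := fun y => (x, y)) (by intro a _ b _ h; simpa using h)
  constructor
  · intro h
    have hx : x ≠ 0 := by rintro rfl; exact h (h0 y)
    have hy : y ≠ 0 := by rintro rfl; exact h (h0' x)
    have h1 : y ≤ rowLen f x := le_csSup hbdd h
    rw [hs x, dstair, if_neg hx] at h1
    omega
  · rintro ⟨hx, hy, hxy⟩
    have h1 : rowLen f x = n - x := by rw [hs x, dstair, if_neg (by omega)]
    have hne : ({y | f (x, y) ≠ 0} : Set ℕ).Nonempty := by
      by_contra hcon
      rw [Set.not_nonempty_iff_eq_empty] at hcon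
      rw [rowLen, hcon] at h1
      simp at h1
      omega
    have hm : f (x, rowLen f x) ≠ 0 := Nat.sSup_mem hne hbdd
    rw [h1] at hm
    exact hdown x (n - x) x y hx le_rfl hy (by omega) hm

lemma low_spec (hT : IsTableau f) (r x : ℕ) :
    f (x, lowLen f r x) ≤ r ∧
      ¬ (f (x, lowLen f r x + 1) ≠ 0 ∧ f (x, lowLen f r x + 1) ≤ r) := by
  obtain ⟨h0, h0', hfin, -⟩ := hT
  have hbdd : BddAbove {y | f (x, y) ≠ 0 ∧ f (x, y) ≤ r} := by
    apply Set.Finite.bddAbove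
    apply (hfin.preimage (f := fun y => (x, y)) (by intro a _ b _ h; simpa using h)).subset
    intro y hy
    exact hy.1
  constructor
  · by_cases hne : ({y | f (x, y) ≠ 0 ∧ f (x, y) ≤ r} : Set ℕ).Nonempty
    · exact (Nat.sSup_mem hne hbdd).2
    · rw [Set.not_nonempty_iff_eq_empty] at hne
      rw [lowLen, hne]
      simp [h0']
  · intro h
    have : lowLen f r x + 1 ≤ lowLen f r x := le_csSup hbdd h
    omega

lemma hatD_spec (hn : 1 ≤ n) (f : ℕ × ℕ → ℕ) (r : ℕ) :
    1 ≤ hatD f n r ∧ hatD f n r ≤ n ∧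
      (hatD f n r < n → f (hatD f n r, n - hatD f n r) ≤ r) ∧
      ∀ k, 1 ≤ k → k < hatD f n r → f (k, n - k) ≠ 0 → r < f (k, n - k) := by
  have hmem : hatD f n r ∈ ({k | 1 ≤ k ∧ k ≤ n - 1 ∧ 1 ≤ f (k, n - k) ∧ f (k, n - k) ≤ r} ∪ {n} : Set ℕ) :=
    Nat.sInf_mem ⟨n, by simp⟩
  have hle : ∀ k ∈ ({k | 1 ≤ k ∧ k ≤ n - 1 ∧ 1 ≤ f (k, n - k) ∧ f (k, n - k) ≤ r} ∪ {n} : Set ℕ),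
      hatD f n r ≤ k := fun k hk => Nat.sInf_le hk
  have hn' := hle n (by simp)
  simp only [Set.mem_union, Set.mem_setOf_eq, Set.mem_singleton_iff] at hmem hle
  refine ⟨by omega, hn', ?_, ?_⟩
  · intro h
    rcases hmem with h1 | h1
    · exact h1.2.2.2
    · omega
  · intro k hk hkd hne
    by_contra hcon
    have := hle k (Or.inl ⟨hk, by omega, by omega, by omega⟩)
    omega

/-- Abstract data describing `g = hatFun f n r`, `d = hatD f n r`. -/
structure HatData (f g : ℕ × ℕ → ℕ) (n r d : ℕ) : Prop where
  supp : ∀ x y, f (x, y) ≠ 0 ↔ 1 ≤ x ∧ 1 ≤ y ∧ x + y ≤ n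
  d1 : 1 ≤ d
  dn : d ≤ n
  big : ∀ k, 1 ≤ k → k < d → r < f (k, n - k)
  rowd : ∀ y, f (d, y) ≤ r
  zero : ∀ y, g (0, y) = 0
  up : ∀ x j, 1 ≤ x → x ≤ d → 1 ≤ j → ((∃ y, g (x, y) = j) ↔
    (j ≤ r ∧ ∃ y, f (x, y) = j) ∨ j = r + 1 ∨ (r + 1 < j ∧ ∃ y, f (x, y) = j - 1))
  down : ∀ x y, d < x → g (x, y) = if f (x - 1, y) ≤ r then f (x - 1, y) else f (x - 1, y) + 1
  diagU : ∀ k, 1 ≤ k → k < d → g (k, n + 1 - k) = f (k, n - k) + 1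
  diagD : g (d, n + 1 - d) = r + 1

lemma hatData (hn : 1 ≤ n) (hT : IsTableau f) (hs : ∀ x, rowLen f x = dstair n x) :
    HatData f (hatFun f n r) n r (hatD f n r) := by
  have hsupp := supp_iff hT hs
  have hlow := low_spec hT r
  obtain ⟨d1, dn, hdle, hbig⟩ := hatD_spec hn f r
  obtain ⟨h0, h0', -, -, hrow, -, -⟩ := hT
  have hrowd : ∀ y, f (hatD f n r, y) ≤ r := by
    intro y
    by_cases hy : f (hatD f n r, y) = 0
    · omega
    have h1 := (hsupp _ _).1 hy
    have key : ∀ t, ∀ y, 1 ≤ y → hatD f n r + y + t = n → f (hatD f n r, y) ≤ r := by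
      intro t
      induction t with
      | zero =>
        intro y hy hyn
        have := hdle (by omega)
        rwa [show n - hatD f n r = y by omega] at this
      | succ t ih =>
        intro y hy hyn
        have h2 := ih (y + 1) (by omega) (by omega)
        have h3 := hrow (hatD f n r) y ((hsupp _ _).2 (by omega)) ((hsupp _ _).2 (by omega))
        omega
    exact key (n - hatD f n r - y) y h1.2.1 (by omega)
  have hbig' : ∀ k, 1 ≤ k → k < hatD f n r → r < f (k, n - k) := by
    intro k hk hkd
    exact hbig k hk hkd ((hsupp _ _).2 (by omega))
  have hz : ∀ x y, n < x + y → f (x, y) = 0 := by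
    intro x y h
    by_contra hc
    have := (hsupp _ _).1 hc
    omega
  have hstep : ∀ x y, r < f (x, y) → ¬ (f (x, y + 1) ≠ 0 ∧ f (x, y + 1) ≤ r) := by
    rintro x y h ⟨h1, h2⟩
    have := hrow x y (by omega) h1
    omega
  refine ⟨hsupp, d1, dn, hbig', hrowd, ?_, ?_, ?_, ?_, ?_⟩
  · intro y; simp [hatFun]
  · intro x j hx hxd hj
    constructor
    · rintro ⟨y, hy⟩
      by_cases hy0 : y = 0
      · subst hy0; simp [hatFun] at hy; omega
      simp only [hatFun] at hy
      rw [if_neg (by omega), if_pos hxd] at hy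
      split_ifs at hy with h1 h2 h3
      · exact Or.inl ⟨by omega, y, hy⟩
      · exact Or.inr (Or.inl hy.symm)
      · exact Or.inr (Or.inr ⟨by omega, y - 1, by omega⟩)
      · omega
    · rintro (⟨h1, y, hy⟩ | h1 | ⟨h1, y, hy⟩)
      · refine ⟨y, ?_⟩
        have := (hsupp x y).1 (by omega)
        simp only [hatFun]
        rw [if_neg (by omega), if_pos hxd, if_pos (by omega), hy]
      · refine ⟨lowLen f r x + 1, ?_⟩
        simp only [hatFun]
        rw [if_neg (by omega), if_pos hxd, if_neg (hlow x).2, if_pos trivial, h1]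
      · refine ⟨y + 1, ?_⟩
        have h2 : y ≠ lowLen f r x := by
          rintro rfl
          have := (hlow x).1
          omega
        simp only [hatFun]
        rw [if_neg (by omega), if_pos hxd, if_neg (hstep x y (by omega)), if_neg (by omega),
          Nat.add_sub_cancel, if_pos (by omega)]
        omega
  · intro x y hx
    simp only [hatFun]
    by_cases hy : y = 0
    · subst hy; simp [h0']
    rw [if_neg (by omega), if_neg (by omega)]
    by_cases hx1 : x = hatD f n r + 1
    · rw [if_pos hx1]
      have : x - 1 = hatD f n r := by omega
      rw [this, if_pos (hrowd y)]
    · rw [if_neg hx1]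
      split_ifs <;> omega
  · intro k hk hkd
    have hb := hbig' k hk hkd
    have h2 : n - k ≠ lowLen f r k := by
      intro h
      have := (hlow k).1
      rw [← h] at this
      omega
    simp only [hatFun]
    rw [if_neg (by omega), if_pos hkd.le, if_neg (by simp [hz k (n + 1 - k) (by omega)]),
      if_neg (by omega), show n + 1 - k - 1 = n - k by omega, if_pos hb]
  · have h2 : lowLen f r (hatD f n r) = n - hatD f n r := by
      have h3 := (hlow (hatD f n r)).2
      have h4 := (hsupp (hatD f n r) (lowLen f r (hatD f n r) + 1))
      have h5 := hrowd (lowLen f r (hatD f n r) + 1)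
      have h6 : ¬ (hatD f n r + (lowLen f r (hatD f n r) + 1) ≤ n) := by
        intro h
        exact h3 ⟨h4.2 (by omega), h5⟩
      by_contra hcon
      have h7 : n - hatD f n r < lowLen f r (hatD f n r) := by omega
      have h8 : lowLen f r (hatD f n r) ≤ n - hatD f n r := by
        unfold lowLen
        by_cases hne : ({y | f (hatD f n r, y) ≠ 0 ∧ f (hatD f n r, y) ≤ r} : Set ℕ).Nonempty
        · apply csSup_le hne
          intro y hy
          have := (hsupp _ _).1 hy.1
          omega
        · rw [Set.not_nonempty_iff_eq_empty] at hne
          rw [hne]; simp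
      omega
    simp only [hatFun]
    rw [if_neg (by omega), if_pos le_rfl, if_neg (by simp [hz (hatD f n r) (n + 1 - hatD f n r) (by omega)]),
      if_pos (by omega)]

variable {g : ℕ × ℕ → ℕ} {d : ℕ}

lemma HatData.diagL (H : HatData f g n r d) (k : ℕ) (hk : d < k) :
    g (k, n + 1 - k) = if f (k - 1, n - (k - 1)) ≤ r then f (k - 1, n - (k - 1))
      else f (k - 1, n - (k - 1)) + 1 := by
  rw [H.down k _ hk, show n + 1 - k = n - (k - 1) by have := H.d1; omega]

lemma HatData.pfs_new (H : HatData f g n r d) : HasPlusFullSet g (n + 1) (r + 1) := by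
  have d1 := H.d1
  have dn := H.dn
  refine ⟨d, ⟨(H.up 1 (r + 1) le_rfl d1 (by omega)).2 (by simp), d1, by omega, H.diagD, ?_⟩, ?_⟩
  · intro x y hxy
    by_contra hx
    rw [H.down x y (by omega)] at hxy
    split_ifs at hxy <;> omega
  · by_cases h : d = n
    · left; omega
    · right
      refine ⟨by omega, ?_⟩
      have := H.diagL (d + 1) (by omega)
      rw [show n + 1 - d - 1 = n + 1 - (d + 1) by omega, this]
      simp only [Nat.add_sub_cancel]
      have h2 := H.rowd (n - d)
      rw [if_pos h2]
      omega

lemma HatData.pfs_up (H : HatData f g n r d) {j : ℕ} (hj : r < j) (h : HasPlusFullSet f n j) :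
    HasPlusFullSet g (n + 1) (j + 1) := by
  have d1 := H.d1
  have dn := H.dn
  obtain ⟨k, ⟨h1, hk1, hkn, hkj, hend⟩, hplus⟩ := h
  have hkd : k ≠ d := by
    rintro rfl
    have := H.rowd (n - k)
    omega
  have hrow1 : ∃ y, g (1, y) = j + 1 :=
    (H.up 1 (j + 1) le_rfl d1 (by omega)).2 (Or.inr (Or.inr ⟨by omega, by simpa using h1⟩))
  rcases lt_or_gt_of_ne hkd with hlt | hgt
  · refine ⟨k, ⟨hrow1, hk1, by omega, by rw [H.diagU k hk1 hlt, hkj], ?_⟩, ?_⟩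
    · intro x y hxy
      by_cases hx0 : x = 0
      · omega
      by_cases hxd : x ≤ d
      · rcases (H.up x (j + 1) (by omega) hxd (by omega)).1 ⟨y, hxy⟩ with h2 | h2 | ⟨_, y', h2⟩
        · omega
        · omega
        · exact hend x y' (by simpa using h2)
      · rw [H.down x y (by omega)] at hxy
        split_ifs at hxy with h2
        · omega
        · have := hend (x - 1) y (by omega)
          omega
    · right
      refine ⟨by omega, ?_⟩
      rw [show n + 1 - k - 1 = n + 1 - (k + 1) by omega]
      by_cases hk2 : k + 1 < d
      · rw [H.diagU (k + 1) (by omega) hk2]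
        rcases hplus with h2 | h2
        · omega
        · have := h2.2
          rw [show n - k - 1 = n - (k + 1) by omega] at this
          omega
      · have : k + 1 = d := by omega
        rw [this, H.diagD]; omega
  · refine ⟨k + 1, ⟨hrow1, by omega, by omega, ?_, ?_⟩, ?_⟩
    · rw [H.diagL (k + 1) (by omega)]
      simp only [Nat.add_sub_cancel]
      rw [if_neg (by omega), hkj]
    · intro x y hxy
      by_cases hxd : x ≤ d
      · omega
      · rw [H.down x y (by omega)] at hxy
        split_ifs at hxy with h2
        · omega
        · have := hend (x - 1) y (by omega)
          omega
    · rcases hplus with h2 | ⟨h2, h3⟩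
      · left; omega
      · right
        refine ⟨by omega, ?_⟩
        rw [show n + 1 - (k + 1) - 1 = n + 1 - (k + 1 + 1) by omega, H.diagL (k + 1 + 1) (by omega)]
        simp only [Nat.add_sub_cancel]
        rw [show n - k - 1 = n - (k + 1) by omega] at h3
        split_ifs <;> omega

lemma HatData.pfs_down (H : HatData f g n r d) {j : ℕ} (h : HasPlusFullSet g (n + 1) j) :
    j = r + 1 ∨ (1 ≤ j ∧ j ≤ r ∧ HasPlusFullSet f n j) ∨
      (r + 1 < j ∧ HasPlusFullSet f n (j - 1)) := by
  have d1 := H.d1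
  have dn := H.dn
  obtain ⟨k, ⟨h1, hk1, hkn, hkj, hend⟩, hplus⟩ := h
  by_cases hjr : j = r + 1
  · exact Or.inl hjr
  right
  have hplus' : k = n ∨ (k < n ∧ g (k + 1, n + 1 - (k + 1)) < j) := by
    rcases hplus with h2 | ⟨h2, h3⟩
    · left; omega
    · rw [show n + 1 - k - 1 = n + 1 - (k + 1) by omega] at h3
      by_cases hkn : k = n
      · left; exact hkn
      · right; exact ⟨by omega, h3⟩
  clear hplus
  rcases lt_trichotomy k d with hlt | heq | hgt
  · -- end row above `d`
    right
    rw [H.diagU k hk1 hlt] at hkj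
    have hb := H.big k hk1 hlt
    have hj : r + 1 < j := by omega
    refine ⟨hj, k, ⟨?_, hk1, by omega, by omega, ?_⟩, ?_⟩
    · rcases (H.up 1 j le_rfl d1 (by omega)).1 h1 with h2 | h2 | h2
      · omega
      · omega
      · exact h2.2
    · intro x y hxy
      have hs := (H.supp x y).1 (by omega)
      by_cases hxd : x ≤ d
      · obtain ⟨y', hy'⟩ := (H.up x j (by omega) hxd (by omega)).2 (Or.inr (Or.inr ⟨hj, y, hxy⟩))
        exact hend x y' hy'
      · have := hend (x + 1) y (by
          rw [H.down (x + 1) y (by omega)]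
          simp only [Nat.add_sub_cancel]
          rw [if_neg (by omega)]; omega)
        omega
    · by_cases hk2 : k = n - 1
      · exact Or.inl hk2
      · right
        refine ⟨by omega, ?_⟩
        rw [show n - k - 1 = n - (k + 1) by omega]
        by_cases hk3 : k + 1 < d
        · rcases hplus' with h2 | ⟨h2, h3⟩
          · omega
          · rw [H.diagU (k + 1) (by omega) hk3] at h3
            omega
        · have hk4 : k + 1 = d := by omega
          have := H.rowd (n - (k + 1))
          rw [← hk4] at this
          omega
  · subst heq
    rw [H.diagD] at hkj
    omega
  · have hdl := H.diagL k hgt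
    rw [hkj] at hdl
    have hne : f (k - 1, n - (k - 1)) ≠ 0 := (H.supp _ _).2 (by omega)
    by_cases hjr' : j ≤ r
    · left
      have hfk : f (k - 1, n - (k - 1)) = j := by
        split_ifs at hdl <;> omega
      refine ⟨by omega, hjr', k - 1, ⟨?_, by omega, by omega, hfk, ?_⟩, ?_⟩
      · rcases (H.up 1 j le_rfl d1 (by omega)).1 h1 with h2 | h2 | h2
        · exact h2.2
        · omega
        · omega
      · intro x y hxy
        by_cases hxd : x < d
        · omega
        · have := hend (x + 1) y (by
            rw [H.down (x + 1) y (by omega)]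
            simp only [Nat.add_sub_cancel]
            rw [if_pos (by omega)]; omega)
          omega
      · rcases hplus' with h2 | ⟨h2, h3⟩
        · left; omega
        · right
          refine ⟨by omega, ?_⟩
          rw [H.diagL (k + 1) (by omega)] at h3
          simp only [Nat.add_sub_cancel] at h3
          rw [show k - 1 + 1 = k by omega, show n - (k - 1) - 1 = n - k by omega]
          split_ifs at h3 <;> omega
    · right
      have hfk : f (k - 1, n - (k - 1)) = j - 1 := by
        split_ifs at hdl <;> omega
      refine ⟨by omega, k - 1, ⟨?_, by omega, by omega, hfk, ?_⟩, ?_⟩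
      · rcases (H.up 1 j le_rfl d1 (by omega)).1 h1 with h2 | h2 | h2
        · omega
        · omega
        · exact h2.2
      · intro x y hxy
        by_cases hxd : x < d
        · omega
        · have := hend (x + 1) y (by
            rw [H.down (x + 1) y (by omega)]
            simp only [Nat.add_sub_cancel]
            rw [if_neg (by omega)]; omega)
          omega
      · rcases hplus' with h2 | ⟨h2, h3⟩
        · left; omega
        · right
          refine ⟨by omega, ?_⟩
          rw [H.diagL (k + 1) (by omega)] at h3
          simp only [Nat.add_sub_cancel] at h3
          rw [show k - 1 + 1 = k by omega, show n - (k - 1) - 1 = n - k by omega]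
          split_ifs at h3 <;> omega

end helpers

/-- **Proposition 5.1.**  Each `C` in the domain of `φ_{i,n}^r` has one less plus-full-set than
its image `φ_{i,n}^r(C) = Ĉ(r)`. -/
theorem image_has_one_more_pfs (i : ℤ) (hi : -1 ≤ i) (n : ℕ) (hn : 1 ≤ n) (r : ℕ)
    (hr : (r : ℤ) ≤ (n : ℤ) + i) (C : ℕ × ℕ → ℕ) (hC : MemC i n C)
    (hdom : ∀ j, 1 ≤ j → j ≤ r → ¬ HasPlusFullSet C n j) :
    Set.ncard {j : ℕ | HasPlusFullSet (hatFun C n r) (n + 1) j} =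
      Set.ncard {j : ℕ | HasPlusFullSet C n j} + 1 := by
  obtain ⟨hT, -, hs, -⟩ := hC
  have H := hatData (r := r) hn hT hs
  have hbig : ∀ j, HasPlusFullSet C n j → r < j := by
    intro j hj
    by_contra hcon
    by_cases hj0 : j = 0
    · obtain ⟨k, ⟨-, hk1, hkn, hkj, -⟩, -⟩ := hj
      exact (H.supp k (n - k)).2 (by omega) (by omega)
    · exact hdom j (by omega) (by omega) hj
  have hset : {j : ℕ | HasPlusFullSet (hatFun C n r) (n + 1) j} =
      insert (r + 1) ((fun j => j + 1) '' {j : ℕ | HasPlusFullSet C n j}) := by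
    ext j
    simp only [Set.mem_setOf_eq, Set.mem_insert_iff, Set.mem_image]
    constructor
    · intro h
      rcases H.pfs_down h with h1 | ⟨h1, h2, h3⟩ | ⟨h1, h2⟩
      · exact Or.inl h1
      · exact absurd h3 (hdom j h1 h2)
      · exact Or.inr ⟨j - 1, h2, by omega⟩
    · rintro (rfl | ⟨j', h1, rfl⟩)
      · exact H.pfs_new
      · exact H.pfs_up (hbig j' h1) h1
  have hfin : {j : ℕ | HasPlusFullSet C n j}.Finite := by
    apply ((Set.finite_Iic n).image (fun k => C (k, n - k))).subset
    rintro j ⟨k, ⟨-, hk1, hkn, hkj, -⟩, -⟩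
    exact ⟨k, by simp only [Set.mem_Iic]; omega, hkj⟩
  rw [hset, Set.ncard_insert_of_notMem _ (hfin.image _),
    Set.ncard_image_of_injective _ (add_left_injective 1)]
  rintro ⟨j, hj, hj'⟩
  have := hbig j hj
  simp only at hj'
  omega

end TamariMaxChains
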